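/- Let q ≥ 1 be an integer and let φ₁*, φ₂* be as in the context. Then ⟨φ₁*, φ₂*⟩ = (−1)^{q−1}/(q(q+1)(q+2)), where ⟨f,g⟩ = ∫₀¹ f(x)g(x) dx. -/

import Mathlib

open Polynomial

/-- The Jacobi-type polynomial sequence: G 1 = 1, G 2 = X - 1/2, and for k ≥ 3,
    G k = (X - 1/2)·G (k-1) - ((k-2)(k+2)/(4(2k-1)(2k+1)))·G (k-2). -/
noncomputable def G : ℕ → Polynomial ℝ
  | 0 => 0
  | 1 => 1
  | 2 => Polynomial.X - Polynomial.C (1/2)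
  | (k+3) =>
      (Polynomial.X - Polynomial.C (1/2)) * G (k+2)
        - Polynomial.C ((((k:ℝ)+1)*((k:ℝ)+5))/(4*(2*(k:ℝ)+5)*(2*(k:ℝ)+7))) * G (k+1)

/-- ψ_k = ((2k+2)!/((k−1)!·(k+1)!))·X(1−X)·G_k. -/
noncomputable def psi (k : ℕ) : Polynomial ℝ :=
  Polynomial.C ((Nat.factorial (2*k+2) : ℝ) /
      ((Nat.factorial (k-1) : ℝ) * (Nat.factorial (k+1) : ℝ)))
    * (Polynomial.X * (1 - Polynomial.X)) * G k

/-- φ₁* = X − ∑_{k=1}^{q−1} ((2k+3)/(k(k+1)(k+2)(k+3)))·ψ_k. -/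
noncomputable def phiStar1 (q : ℕ) : Polynomial ℝ :=
  Polynomial.X - ∑ k ∈ Finset.Icc 1 (q-1),
    Polynomial.C ((2*(k:ℝ)+3)/((k:ℝ)*((k:ℝ)+1)*((k:ℝ)+2)*((k:ℝ)+3))) * psi k

/-- φ₂* = (1−X) − ∑_{k=1}^{q−1} ((−1)^{k−1}(2k+3)/(k(k+1)(k+2)(k+3)))·ψ_k. -/
noncomputable def phiStar2 (q : ℕ) : Polynomial ℝ :=
  (1 - Polynomial.X) - ∑ k ∈ Finset.Icc 1 (q-1),
    Polynomial.C ((-1:ℝ)^(k-1) * (2*(k:ℝ)+3)/((k:ℝ)*((k:ℝ)+1)*((k:ℝ)+2)*((k:ℝ)+3))) * psi k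

noncomputable def LL (p : ℝ[X]) : ℝ := ∫ x in (0:ℝ)..1, p.eval x

lemma LL_int (p : ℝ[X]) : IntervalIntegrable (fun x => p.eval x) MeasureTheory.volume 0 1 :=
  p.continuous.intervalIntegrable 0 1

lemma LL_add (p r : ℝ[X]) : LL (p + r) = LL p + LL r := by
  simp only [LL, eval_add]
  exact intervalIntegral.integral_add (LL_int p) (LL_int r)

lemma LL_sub (p r : ℝ[X]) : LL (p - r) = LL p - LL r := by
  simp only [LL, eval_sub]
  exact intervalIntegral.integral_sub (LL_int p) (LL_int r)

lemma LL_C (a : ℝ) (p : ℝ[X]) : LL (C a * p) = a * LL p := by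
  simp [LL]

lemma LL_zero : LL 0 = 0 := by simp [LL]

lemma LL_sum (s : Finset ℕ) (f : ℕ → ℝ[X]) : LL (∑ i ∈ s, f i) = ∑ i ∈ s, LL (f i) := by
  classical
  induction s using Finset.induction_on with
  | empty => simp [LL_zero]
  | insert a s ha ih => rw [Finset.sum_insert ha, Finset.sum_insert ha, LL_add, ih]

lemma LL_deriv (p : ℝ[X]) : LL (derivative p) = p.eval 1 - p.eval 0 := by
  unfold LL
  apply intervalIntegral.integral_eq_sub_of_hasDerivAt (f := fun x => p.eval x)
    (f' := fun x => (derivative p).eval x)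
  · intro x _
    exact p.hasDerivAt x
  · exact LL_int _

noncomputable def cc (k : ℕ) : ℝ := (Nat.factorial (2*k+2) : ℝ) /
      ((Nat.factorial (k-1) : ℝ) * (Nat.factorial (k+1) : ℝ))

noncomputable def HH (k : ℕ) : ℝ[X] := C (cc k) * G k

noncomputable def ww : ℝ[X] := X * (1 - X)
noncomputable def tt : ℝ[X] := 2 * X - 1

lemma psi_eq (k : ℕ) : psi k = ww * HH k := by
  unfold psi ww HH cc; ring

lemma cc_succ (k : ℕ) : ((k:ℝ)+1) * cc (k+2) = 2*(2*k+5) * cc (k+1) := by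
  unfold cc
  have e1 : 2*(k+2)+2 = (2*k+4)+1+1 := by ring
  have e2 : 2*(k+1)+2 = 2*k+4 := by ring
  have e3 : k+2-1 = k+1 := by omega
  have e4 : k+1-1 = k := by omega
  rw [e1, e2, e3, e4]
  have e5 : k+2+1 = (k+1+1)+1 := by ring
  rw [e5, Nat.factorial_succ (2*k+4+1), Nat.factorial_succ (2*k+4), Nat.factorial_succ (k+1+1),
    Nat.factorial_succ k]
  have h1 : (Nat.factorial k : ℝ) ≠ 0 := by exact_mod_cast Nat.factorial_ne_zero k
  have h2 : (Nat.factorial (k+1+1) : ℝ) ≠ 0 := by exact_mod_cast Nat.factorial_ne_zero _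
  have h3 : (k:ℝ)+1 ≠ 0 := by positivity
  have h4 : (k:ℝ)+1+1+1 ≠ 0 := by positivity
  push_cast
  field_simp
  ring

lemma HH_zero : HH 0 = 0 := by simp [HH, G]
lemma HH_one : HH 1 = 12 := by
  have : cc 1 = 12 := by norm_num [cc, Nat.factorial]
  rw [HH, this, G, mul_one]
  rfl

lemma HH_rec (k : ℕ) : C ((k:ℝ)+1) * HH (k+2)
    = C (2*(k:ℝ)+5) * (tt * HH (k+1)) - C ((k:ℝ)+4) * HH k := by
  have ht : tt = C 2 * (X - C (1/2)) := by
    apply Polynomial.funext; intro x; simp [tt]; ring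
  rcases k with _ | k
  · have h := cc_succ 0
    rw [HH_zero, ht]
    simp only [HH, G]
    norm_num at h
    apply Polynomial.funext
    intro x
    simp [h]
    ring
  · have h1 := cc_succ k
    have h2 := cc_succ (k+1)
    have h3 : (k:ℝ)+1 ≠ 0 := by positivity
    have h4 : 2*(k:ℝ)+5 ≠ 0 := by positivity
    have h5 : 2*(k:ℝ)+7 ≠ 0 := by positivity
    push_cast at h2 ⊢
    simp only [HH]
    rw [show G (k+1+2) = (X - C (1/2)) * G (k+2)
        - C ((((k:ℝ)+1)*((k:ℝ)+5))/(4*(2*(k:ℝ)+5)*(2*(k:ℝ)+7))) * G (k+1) from by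
          rw [show k+1+2 = k+3 from rfl, G], ht]
    have e1 : ((k:ℝ)+1+1) * cc (k+1+2) = (2*((k:ℝ)+1)+5) * 2 * cc (k+1+1) := by
      rw [h2]; ring
    have e2 : ((k:ℝ)+1+1) * cc (k+1+2) * ((((k:ℝ)+1)*((k:ℝ)+5))/(4*(2*(k:ℝ)+5)*(2*(k:ℝ)+7)))
        = ((k:ℝ)+1+4) * cc (k+1) := by
      rw [h2]
      have : cc (k+1+1) = 2*(2*k+5) * cc (k+1) / ((k:ℝ)+1) := by
        rw [eq_div_iff h3, ← h1]; ring
      rw [this]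
      field_simp
      ring
    have E1 := congrArg (C : ℝ → ℝ[X]) e1
    have E2 := congrArg (C : ℝ → ℝ[X]) e2
    simp only [C_mul] at E1 E2
    rw [show k+1+1 = k+2 from rfl] at *
    linear_combination ((X - C (1/2)) * G (k+2)) * E1 - G (k+1) * E2

lemma HH_der (k : ℕ) :
    2 * ww * derivative (HH (k+1)) = - C (k:ℝ) * (tt * HH (k+1)) + C ((k:ℝ)+4) * HH k ∧
    2 * ww * derivative (HH k) = C ((k:ℝ)+4) * (tt * HH k) - C (k:ℝ) * HH (k+1) := by
  have dt : derivative tt = 2 := by simp [tt]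
  have h4 : 4 * ww = 1 - tt^2 := by unfold ww tt; ring
  induction k with
  | zero => simp [HH_zero, HH_one]
  | succ k ih =>
    obtain ⟨a, b⟩ := ih
    have r := HH_rec k
    have hne : (C ((k:ℝ)+1) : ℝ[X]) ≠ 0 := by
      rw [Ne, C_eq_zero]; positivity
    have r' := congrArg derivative r
    simp only [derivative_mul, derivative_sub, derivative_C, dt, zero_mul, zero_add] at r'
    simp only [C_add, C_mul] at *
    push_cast
    simp only [C_add, C_mul] at *
    simp only [show (C (1:ℝ):ℝ[X]) = 1 from rfl, show (C (2:ℝ):ℝ[X]) = 2 from rfl,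
      show (C (4:ℝ):ℝ[X]) = 4 from rfl, show (C (5:ℝ):ℝ[X]) = 5 from rfl] at *
    have b' : 2 * ww * derivative (HH (k+1)) =
      (C (k:ℝ) + 1 + 4) * (tt * HH (k+1)) - (C (k:ℝ) + 1) * HH (k+1+1) := by
      linear_combination a + r
    refine ⟨?_, b'⟩
    apply mul_left_cancel₀ hne
    generalize (C (k:ℝ) : ℝ[X]) = K at *
    rw [show k+1+1 = k+2 from rfl] at *
    linear_combination (2*ww) * r' + (2*K+5)*tt*a - (K+4)*b + (2*K+5)*HH (k+1)*h4 + (K+1)*tt*r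

noncomputable def AA (k : ℕ) : ℝ := LL (ww * HH k)
noncomputable def BB (k : ℕ) : ℝ := LL (ww * (tt * HH k))

lemma dw : derivative ww = - tt := by
  simp [ww, tt]; ring

lemma AB (k : ℕ) : BB (k+1) = AA (k+2) ∧ BB (k+1) = AA k := by
  have h0 : LL (derivative (ww^2 * HH (k+1))) = 0 := by
    rw [LL_deriv]; simp [ww]
  have d : C 2 * derivative (ww^2 * HH (k+1)) = ww * (2 * ww * derivative (HH (k+1)))
      - C 4 * (ww * (tt * HH (k+1))) := by
    simp only [derivative_mul, derivative_pow, dw, show (C (2:ℝ):ℝ[X]) = 2 from rfl,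
      show (C (4:ℝ):ℝ[X]) = 4 from rfl]
    push_cast
    simp only [show (C (2:ℝ):ℝ[X]) = 2 from rfl]
    ring
  constructor
  · have h := (HH_der (k+1)).2
    rw [h] at d
    have d2 : C 2 * derivative (ww^2 * HH (k+1)) = C ((k:ℝ)+1) * (ww * (tt * HH (k+1)))
      - C ((k:ℝ)+1) * (ww * HH (k+2)) := by
      rw [d]; push_cast; simp only [C_add]; ring
    have := congrArg LL d2
    rw [LL_C, h0, LL_sub, LL_C, LL_C] at this
    have h3 : (k:ℝ)+1 ≠ 0 := by positivity
    apply mul_left_cancel₀ h3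
    unfold AA BB
    linarith
  · have h := (HH_der k).1
    rw [h] at d
    have d2 : C 2 * derivative (ww^2 * HH (k+1)) = C ((k:ℝ)+4) * (ww * HH k)
      - C ((k:ℝ)+4) * (ww * (tt * HH (k+1))) := by
      rw [d]; simp only [C_add]; ring
    have := congrArg LL d2
    rw [LL_C, h0, LL_sub, LL_C, LL_C] at this
    have h3 : (k:ℝ)+4 ≠ 0 := by positivity
    apply mul_left_cancel₀ h3
    unfold AA BB
    linarith

lemma AA_one : AA 1 = 2 := by
  have : derivative (6 * X^2 - 4 * X^3 : ℝ[X]) = ww * HH 1 := by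
    rw [HH_one, ww]
    simp [derivative_mul, derivative_pow]
    simp only [show (C (2:ℝ):ℝ[X]) = 2 from rfl, show (C (3:ℝ):ℝ[X]) = 3 from rfl]
    ring
  rw [AA, ← this, LL_deriv]
  norm_num

lemma AA_val (k : ℕ) : AA k = 1 - (-1)^k ∧ AA (k+1) = 1 + (-1)^k := by
  induction k with
  | zero => 
    refine ⟨by simp [AA, HH_zero, LL_zero], by rw [AA_one]; norm_num⟩
  | succ k ih =>
    refine ⟨by rw [ih.2]; ring, ?_⟩
    have := AB k
    rw [show k+1+1=k+2 from rfl, ← this.1, this.2, ih.1]; ring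

lemma BB_val (k : ℕ) : BB (k+1) = 1 - (-1)^k := by
  rw [(AB k).2, (AA_val k).1]

noncomputable def aa (k j : ℕ) : ℝ := LL (ww * HH k * (ww * HH j))

lemma aa_comm (k j : ℕ) : aa k j = aa j k := by
  unfold aa; rw [mul_comm]

lemma aa_zero (k : ℕ) : aa k 0 = 0 := by
  unfold aa; simp [HH_zero, LL_zero]

lemma aa_one (k : ℕ) : aa (k+2) 1 = 0 := by
  have e : C (2*(k:ℝ)+7) * (ww * HH (k+2) * (ww * HH 1)) =
    C 3 * (C (2*(k:ℝ)+7) * (ww * HH (k+2)) - C ((k:ℝ)+2) * (ww * (tt * HH (k+3)))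
      - C ((k:ℝ)+5) * (ww * (tt * HH (k+1)))) := by
    have h4 : 4 * ww = 1 - tt^2 := by unfold ww tt; ring
    have r := HH_rec (k+1)
    rw [show k+1+2 = k+3 from rfl, show k+1+1 = k+2 from rfl] at r
    push_cast at r
    rw [HH_one]
    simp only [C_add, C_mul] at *
    simp only [show (C (1:ℝ):ℝ[X]) = 1 from rfl, show (C (2:ℝ):ℝ[X]) = 2 from rfl,
      show (C (4:ℝ):ℝ[X]) = 4 from rfl, show (C (5:ℝ):ℝ[X]) = 5 from rfl,
      show (C (3:ℝ):ℝ[X]) = 3 from rfl, show (C (7:ℝ):ℝ[X]) = 7 from rfl] at *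
    linear_combination (3 * ww * tt) * r + (3 * (2 * C (k:ℝ) + 7) * ww * HH (k+2)) * h4
  have := congrArg LL e
  rw [LL_C, LL_C, LL_sub, LL_sub, LL_C, LL_C, LL_C] at this
  have h1 := (AA_val (k+2)).1
  have h2 := BB_val (k+2)
  have h3 := BB_val k
  rw [show k+2+1 = k+3 from rfl] at h2
  unfold AA at h1
  unfold BB at h2 h3
  rw [h1, h2, h3] at this
  have h3 : 2*(k:ℝ)+7 ≠ 0 := by positivity
  apply mul_left_cancel₀ h3
  unfold aa
  rw [this]
  ring

lemma aa_rec (k j : ℕ) :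
    (2*(j:ℝ)+5) * (((k:ℝ)+1) * aa (k+2) (j+1) + ((k:ℝ)+4) * aa k (j+1)) =
    (2*(k:ℝ)+5) * (((j:ℝ)+1) * aa (k+1) (j+2) + ((j:ℝ)+4) * aa (k+1) j) := by
  unfold aa
  rw [← LL_C, ← LL_C, ← LL_C, ← LL_C, ← LL_add, ← LL_add, ← LL_C, ← LL_C]
  refine congrArg LL ?_
  have r := HH_rec k
  have s := HH_rec j
  linear_combination (C (2*(j:ℝ)+5) * ww^2 * HH (j+1)) * r - (C (2*(k:ℝ)+5) * ww^2 * HH (k+1)) * s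

lemma aa_lt (j : ℕ) : (∀ k, j < k → aa k j = 0) ∧ (∀ k, j + 1 < k → aa k (j+1) = 0) := by
  induction j with
  | zero =>
    refine ⟨fun k _ => aa_zero k, fun k hk => ?_⟩
    obtain ⟨m, rfl⟩ : ∃ m, k = m + 2 := ⟨k-2, by omega⟩
    exact aa_one m
  | succ j ih =>
    refine ⟨ih.2, fun k hk => ?_⟩
    obtain ⟨m, rfl⟩ : ∃ m, k = m + 1 := ⟨k-1, by omega⟩
    have h := aa_rec m j
    rw [ih.2 (m+2) (by omega), ih.2 m (by omega), ih.1 (m+1) (by omega)] at h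
    have h3 : (2*(m:ℝ)+5)*((j:ℝ)+1) ≠ 0 := by positivity
    apply mul_left_cancel₀ h3
    rw [show j+1+1 = j+2 from rfl]
    linarith

lemma aa_diag (k : ℕ) : aa (k+1) (k+1) =
    ((k:ℝ)+1)*((k:ℝ)+2)*((k:ℝ)+3)*((k:ℝ)+4)/(2*(k:ℝ)+5) := by
  induction k with
  | zero =>
    have : derivative (C 144 * (C (1/3) * X^3 - C (1/2) * X^4 + C (1/5) * X^5) : ℝ[X])
        = ww * HH 1 * (ww * HH 1) := by
      rw [HH_one, ww]
      apply Polynomial.funext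
      intro x
      simp [derivative_mul, derivative_pow]
      ring
    rw [aa, zero_add, ← this, LL_deriv]
    norm_num
  | succ k ih =>
    have h := aa_rec (k+1) k
    rw [(aa_lt (k+1)).1 (k+1+2) (by omega), ih, (aa_lt k).1 (k+1+1) (by omega)] at h
    rw [show k+1+1 = k+2 from rfl] at *
    push_cast at *
    have h4 : 2*(k:ℝ)+5 ≠ 0 := by positivity
    have h3 : (2*((k:ℝ)+1)+5) ≠ 0 := by positivity
    have h5 : (k:ℝ)+1 ≠ 0 := by positivity
    rw [eq_div_iff h3]
    apply mul_left_cancel₀ h5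
    field_simp at h
    linarith

lemma LL_X (k : ℕ) : LL (X * psi (k+1)) = 1 := by
  have e : X * psi (k+1) = C (1/2) * (ww * HH (k+1) + ww * (tt * HH (k+1))) := by
    have : (X:ℝ[X]) = C (1/2) * (1 + tt) := by
      apply Polynomial.funext; intro x; simp [tt]
    rw [psi_eq]
    nth_rewrite 1 [this]
    ring
  have h1 : LL (ww * HH (k+1)) = _ := (AA_val k).2
  have h2 : LL (ww * (tt * HH (k+1))) = _ := BB_val k
  rw [e, LL_C, LL_add, h1, h2]; ring

lemma LL_1X (k : ℕ) : LL ((1-X) * psi (k+1)) = (-1)^k := by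
  have e : (1-X) * psi (k+1) = ww * HH (k+1) - X * psi (k+1) := by
    rw [psi_eq]; ring
  have h1 : LL (ww * HH (k+1)) = _ := (AA_val k).2
  rw [e, LL_sub, LL_X, h1]; ring

lemma LL_orth (f : ℕ → ℝ) (n : ℕ) :
    LL ((∑ k ∈ Finset.Icc 1 n, C (f k) * psi k) * psi (n+1)) = 0 := by
  rw [Finset.sum_mul, LL_sum]
  apply Finset.sum_eq_zero
  intro i hi
  rw [Finset.mem_Icc] at hi
  rw [mul_assoc, LL_C, psi_eq, psi_eq]
  have := (aa_lt i).1 (n+1) (by omega)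
  rw [aa_comm] at this
  unfold aa at this
  rw [this, mul_zero]

lemma cross_aux (n : ℕ) : LL (phiStar1 (n+1) * phiStar2 (n+1)) =
    (-1:ℝ)^n / (((n:ℝ)+1)*((n:ℝ)+2)*((n:ℝ)+3)) := by
  induction n with
  | zero =>
    have : derivative (C (1/2) * X^2 - C (1/3) * X^3 : ℝ[X]) = phiStar1 (0+1) * phiStar2 (0+1) := by
      apply Polynomial.funext
      intro x
      simp [derivative_mul, derivative_pow, phiStar1, phiStar2]
      ring
    rw [← this, LL_deriv]
    norm_num
  | succ n ih =>
    set c : ℝ := (2*((n+1:ℕ):ℝ)+3)/(((n+1:ℕ):ℝ)*(((n+1:ℕ):ℝ)+1)*(((n+1:ℕ):ℝ)+2)*(((n+1:ℕ):ℝ)+3))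
      with hc
    have s1 : phiStar1 (n+1+1) = phiStar1 (n+1) - C c * psi (n+1) := by
      simp only [phiStar1, Nat.add_sub_cancel]
      rw [Finset.sum_Icc_succ_top (by omega)]
      ring
    have s2 : phiStar2 (n+1+1) = phiStar2 (n+1) - C ((-1)^n * c) * psi (n+1) := by
      simp only [phiStar2, Nat.add_sub_cancel]
      rw [Finset.sum_Icc_succ_top (by omega), hc, Nat.add_sub_cancel, mul_div_assoc]
      ring
    have i1 : LL (phiStar1 (n+1) * psi (n+1)) = 1 := by
      simp only [phiStar1, Nat.add_sub_cancel]
      rw [sub_mul, LL_sub, LL_X, LL_orth, sub_zero]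
    have i2 : LL (phiStar2 (n+1) * psi (n+1)) = (-1)^n := by
      simp only [phiStar2, Nat.add_sub_cancel]
      rw [sub_mul, LL_sub, LL_1X, LL_orth, sub_zero]
    have i3 := aa_diag n
    unfold aa at i3
    rw [← psi_eq] at i3
    have e : phiStar1 (n+1+1) * phiStar2 (n+1+1) = phiStar1 (n+1) * phiStar2 (n+1)
      - C ((-1)^n * c) * (phiStar1 (n+1) * psi (n+1)) - C c * (phiStar2 (n+1) * psi (n+1))
      + C (c * ((-1)^n * c)) * (psi (n+1) * psi (n+1)) := by
      rw [s1, s2, C_mul (a := c)]; ring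
    rw [e, LL_add, LL_sub, LL_sub, LL_C, LL_C, LL_C, i1, i2, i3, ih, hc, pow_succ]
    push_cast
    have h1 : (n:ℝ)+1 ≠ 0 := by positivity
    have h2 : (n:ℝ)+2 ≠ 0 := by positivity
    have h3 : (n:ℝ)+3 ≠ 0 := by positivity
    have h4 : (n:ℝ)+4 ≠ 0 := by positivity
    have h5 : 2*(n:ℝ)+5 ≠ 0 := by positivity
    rw [show (n:ℝ)+1+1 = n+2 by ring, show (n:ℝ)+1+2 = n+3 by ring, show (n:ℝ)+1+3 = n+4 by ring,
      show 2*((n:ℝ)+1)+3 = 2*n+5 by ring]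
    field_simp
    ring

/-- ⟨φ₁*,φ₂*⟩ = (−1)^{q−1}/(q(q+1)(q+2)). -/
theorem phiStar_cross (q : ℕ) (hq : 1 ≤ q) :
    (∫ x in (0:ℝ)..1, (phiStar1 q).eval x * (phiStar2 q).eval x)
      = (-1:ℝ)^(q-1)/((q:ℝ)*((q:ℝ)+1)*((q:ℝ)+2)) := by
  obtain ⟨n, rfl⟩ : ∃ n, q = n + 1 := ⟨q-1, by omega⟩
  have h := cross_aux n
  unfold LL at h
  simp only [eval_mul] at h
  rw [h, Nat.add_sub_cancel]
  push_cast
  congr 1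
  ring
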